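/- Let d ∈ ℕ with d ≥ 1, ν > 0, and κ > 0. Set n = d(d+1)/2, R² = (d³−d)/12, and γ = (2ν/κ² + R²)^{−1/2}. Let V(λ) = ∏_{1 ≤ i < j ≤ d} |λ_i − λ_j|. Let x be a random vector in ℝ^d whose law has Lebesgue density proportional to exp(−γ²‖λ‖²/2) V(λ), and let y be a random variable independent of x whose law is the chi distribution with 2ν degrees of freedom. Then the random vector z = x/y has Lebesgue density on ℝ^d proportional to (2ν/κ² + ‖λ‖² + R²)^{−ν−n/2} V(λ), and in particular this last function has finite positive integral over ℝ^d. -/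

import Mathlib

/-!
STATEMENT 8: on `ℝ^d`, with `n = d(d+1)/2`, `R² = (d³−d)/12` and
`γ = (2ν/κ² + R²)^{−1/2}`, if `x` has density proportional to
`exp(−γ²‖λ‖²/2) V(λ)` where `V` is the absolute Vandermonde product, and `y`
is an independent chi random variable with `2ν` degrees of freedom, then
`z = x / y` has density proportional to
`(2ν/κ² + ‖λ‖² + R²)^{−ν−n/2} V(λ)`, which has finite positive integral.
-/

open MeasureTheory ProbabilityTheory Set

/-- The absolute Vandermonde product `V(λ) = ∏_{i<j} |λ_i − λ_j|`. -/
noncomputable def vandermondeAbs (d : ℕ) (x : EuclideanSpace ℝ (Fin d)) : ℝ :=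
  ∏ p ∈ Finset.univ.filter (fun p : Fin d × Fin d => p.1 < p.2), |x p.1 - x p.2|

/-- Density of the chi distribution with `2ν` degrees of freedom,
proportional to `ψ^{2ν−1}e^{−ψ²/2}` on `(0, ∞)`. -/
noncomputable def chiTwoNuPDF (ν : ℝ) (ψ : ℝ) : ℝ :=
  (2 : ℝ) ^ (1 - ν) * (Real.Gamma ν)⁻¹ * ψ ^ (2 * ν - 1) * Real.exp (-ψ ^ 2 / 2)


lemma vand_cont (d : ℕ) : Continuous (vandermondeAbs d) := by
  unfold vandermondeAbs
  fun_prop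

lemma vand_nonneg (d : ℕ) (x) : 0 ≤ vandermondeAbs d x :=
  Finset.prod_nonneg fun _ _ => abs_nonneg _

noncomputable def vcard (d : ℕ) : ℕ :=
  (Finset.univ.filter (fun p : Fin d × Fin d => p.1 < p.2)).card

lemma vcard_eq (d : ℕ) : (d : ℝ) + vcard d = (d : ℝ) * ((d : ℝ) + 1) / 2 := by
  have h : vcard d = ∑ i ∈ Finset.range d, i := by
    unfold vcard
    rw [Finset.card_filter, ← Finset.univ_product_univ, Finset.sum_product_right]
    rw [← Fin.sum_univ_eq_sum_range (fun i => i) d]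
    refine Finset.sum_congr rfl fun i _ => ?_
    rw [← Finset.card_filter]
    have : (Finset.univ.filter fun x : Fin d => x < i) = Finset.Iio i := by ext; simp
    rw [this, Fin.card_Iio]
  have h2 := Finset.sum_range_id_mul_two d
  rw [← h] at h2
  rcases d with _ | d
  · simp [vcard]
  · simp only [Nat.add_sub_cancel] at h2
    have h3 : (vcard (d+1) : ℝ) * 2 = (d + 1) * d := by exact_mod_cast h2
    push_cast
    linarith

lemma vand_smul (d : ℕ) (r : ℝ) (hr : 0 < r) (x) :
    vandermondeAbs d (r • x) = r ^ vcard d * vandermondeAbs d x := by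
  unfold vandermondeAbs vcard
  rw [← Finset.prod_const, ← Finset.prod_mul_distrib]
  refine Finset.prod_congr rfl fun p _ => ?_
  simp only [PiLp.smul_apply, smul_eq_mul]
  rw [← mul_sub, abs_mul, abs_of_pos hr]

lemma vand_le (d : ℕ) (x) : vandermondeAbs d x ≤ (1 + ‖x‖ ^ 2) ^ vcard d := by
  unfold vandermondeAbs vcard
  rw [← Finset.prod_const]
  refine Finset.prod_le_prod (fun _ _ => abs_nonneg _) fun p _ => ?_
  have h1 : |x p.1| ≤ ‖x‖ := PiLp.norm_apply_le x p.1
  have h2 : |x p.2| ≤ ‖x‖ := PiLp.norm_apply_le x p.2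
  have := abs_sub (x p.1) (x p.2)
  nlinarith [sq_nonneg (‖x‖ - 1)]

lemma vand_ne (d : ℕ) : ∃ x, vandermondeAbs d x ≠ 0 := by
  refine ⟨WithLp.toLp 2 fun i => (i : ℝ), ?_⟩
  unfold vandermondeAbs
  refine Finset.prod_ne_zero_iff.2 fun p hp => ?_
  simp only [Finset.mem_filter, Finset.mem_univ, true_and] at hp
  rw [abs_ne_zero, sub_ne_zero]
  simp only [ne_eq, Nat.cast_inj]
  exact fun h => hp.ne (Fin.ext h)

lemma gauss_int (d : ℕ) (b : ℝ) (hb : 0 < b) :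
    Integrable (fun x : EuclideanSpace ℝ (Fin d) => Real.exp (-b * ‖x‖ ^ 2)) := by
  have h := GaussianFourier.integrable_cexp_neg_mul_sq_norm_add
    (V := EuclideanSpace ℝ (Fin d)) (b := (b : ℂ)) (by simpa using hb) 0 0
  refine h.norm.congr (Filter.Eventually.of_forall fun x => ?_)
  simp [Complex.norm_exp]
  norm_cast
  simp

lemma gv_int (d : ℕ) (b : ℝ) (hb : 0 < b) :
    Integrable (fun x : EuclideanSpace ℝ (Fin d) =>
      Real.exp (-b * ‖x‖ ^ 2) * vandermondeAbs d x) := by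
  set m := vcard d with hm
  have hc := vand_cont d
  refine ((gauss_int d (b/2) (half_pos hb)).const_mul
    (Real.exp (b/2) * (m.factorial / (b/2)^m))).mono' (by fun_prop) ?_
  refine Filter.Eventually.of_forall fun x => ?_
  rw [Real.norm_of_nonneg (mul_nonneg (Real.exp_nonneg _) (vand_nonneg d x))]
  have h1 := Real.pow_div_factorial_le_exp (b/2 * (1 + ‖x‖^2)) (by positivity) m
  have h2 := vand_le d x
  rw [← hm] at h2
  have hf : (0:ℝ) < m.factorial := by positivity
  have h3 : (1 + ‖x‖^2)^m ≤ (m.factorial / (b/2)^m) * Real.exp (b/2 * (1 + ‖x‖^2)) := by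
    rw [mul_pow, div_le_iff₀ hf] at h1
    rw [div_mul_eq_mul_div, le_div_iff₀ (by positivity)]
    linarith
  calc _ ≤ Real.exp (-b * ‖x‖ ^ 2) * ((m.factorial / (b/2)^m) * Real.exp (b/2 * (1 + ‖x‖^2))) := by
        gcongr; exact h2.trans h3
    _ = (m.factorial / (b/2)^m) * (Real.exp (-b * ‖x‖ ^ 2 + b/2 * (1 + ‖x‖^2))) := by
        rw [Real.exp_add]; ring
    _ = (m.factorial / (b/2)^m) * (Real.exp (b/2 + -(b/2) * ‖x‖ ^ 2)) := by
        congr 2; ring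
    _ = _ := by rw [Real.exp_add]; ring

lemma gv_pos (d : ℕ) (b : ℝ) (hb : 0 < b) :
    0 < ∫ x : EuclideanSpace ℝ (Fin d), Real.exp (-b * ‖x‖ ^ 2) * vandermondeAbs d x := by
  have hc := vand_cont d
  obtain ⟨x, hx⟩ := vand_ne d
  exact MeasureTheory.integral_pos_of_integrable_nonneg_nonzero (x := x) (by fun_prop) (gv_int d b hb)
    (fun x => mul_nonneg (Real.exp_nonneg _) (vand_nonneg d x))
    (mul_ne_zero (Real.exp_ne_zero _) hx)

open ENNReal in
lemma lint_scale (d : ℕ) (r : ℝ) (hr : 0 < r) (F : EuclideanSpace ℝ (Fin d) → ℝ≥0∞)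
    (hF : Measurable F) :
    ∫⁻ x, F x = ENNReal.ofReal (r ^ d) * ∫⁻ z, F (r • z) := by
  have h := Measure.map_addHaar_smul (volume : Measure (EuclideanSpace ℝ (Fin d))) hr.ne'
  have h2 : ∫⁻ z, F (r • z) = ∫⁻ x, F x ∂(Measure.map (r • ·) volume) :=
    (lintegral_map hF (measurable_const_smul r)).symm
  rw [h2, h, lintegral_smul_measure, smul_eq_mul, ← mul_assoc, ← ENNReal.ofReal_mul (by positivity)]
  simp only [finrank_euclideanSpace, Fintype.card_fin]
  rw [abs_of_pos (by positivity), mul_inv_cancel₀ (by positivity)]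
  simp

open ENNReal in
lemma map_ratio (d : ℕ) (f : EuclideanSpace ℝ (Fin d) → ℝ≥0∞) (g : ℝ → ℝ≥0∞)
    (hf : Measurable f) (hg : Measurable g) (hg0 : ∀ y, y ≤ 0 → g y = 0)
    [SFinite ((volume : Measure (EuclideanSpace ℝ (Fin d))).withDensity f)]
    [SFinite ((volume : Measure ℝ).withDensity g)] :
    Measure.map (fun p : EuclideanSpace ℝ (Fin d) × ℝ => p.2⁻¹ • p.1)
      ((volume.withDensity f).prod (volume.withDensity g)) =
    volume.withDensity fun z => ∫⁻ y in Ioi 0, g y * (ENNReal.ofReal (y ^ d) * f (y • z)) := by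
  refine Measure.ext_of_lintegral _ fun h hh => ?_
  have hm : Measurable (fun p : EuclideanSpace ℝ (Fin d) × ℝ => p.2⁻¹ • p.1) := by fun_prop
  have hm2 : Measurable (fun p : EuclideanSpace ℝ (Fin d) × ℝ =>
      g p.2 * (ENNReal.ofReal (p.2 ^ d) * f (p.2 • p.1))) := by fun_prop
  rw [lintegral_map hh hm, lintegral_prod_symm' _ (by fun_prop)]
  rw [lintegral_withDensity_eq_lintegral_mul _ hg
    (Measurable.lintegral_prod_left' (f := fun p : EuclideanSpace ℝ (Fin d) × ℝ => h (p.2⁻¹ • p.1))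
      (by fun_prop))]
  rw [lintegral_withDensity_eq_lintegral_mul _ (Measurable.lintegral_prod_right' hm2) hh]
  have e1 : ∀ y, (g * (fun y : ℝ => ∫⁻ x, h (y⁻¹ • x) ∂(volume.withDensity f)) : ℝ → ℝ≥0∞) y =
      (Ioi (0:ℝ)).indicator (fun y => ∫⁻ z, g y * (ENNReal.ofReal (y ^ d) * f (y • z)) * h z) y := by
    intro y
    simp only [Pi.mul_apply]
    by_cases hy : 0 < y
    · rw [indicator_of_mem (by exact hy)]
      rw [lintegral_withDensity_eq_lintegral_mul _ hf (by fun_prop)]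
      rw [lint_scale d y hy _ (by fun_prop)]
      rw [← lintegral_const_mul _ (by fun_prop), ← lintegral_const_mul _ (by fun_prop)]
      refine lintegral_congr fun z => ?_
      simp only [Pi.mul_apply]
      rw [smul_smul, inv_mul_cancel₀ hy.ne', one_smul]
      ring
    · rw [indicator_of_notMem (by exact hy), hg0 y (not_lt.1 hy), zero_mul]
  rw [lintegral_congr e1, lintegral_indicator measurableSet_Ioi]
  rw [lintegral_lintegral_swap]
  · refine lintegral_congr fun z => ?_
    simp only [Pi.mul_apply]
    rw [lintegral_mul_const _ (by fun_prop)]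
  · apply Measurable.aemeasurable
    simp only [Function.uncurry_def]
    fun_prop

lemma inner_int (a s : ℝ) (ha : 0 < a) (hs : 0 < s) (t : ℝ) (ht : 0 ≤ t) :
    ∫⁻ y in Ioi (0:ℝ), ENNReal.ofReal (y ^ (2 * s - 1) * Real.exp (-((1 + t / a) / 2) * y ^ (2:ℝ)))
    = ENNReal.ofReal (((2 * a) ^ s * (1 / 2) * Real.Gamma s) * (a + t) ^ (-s)) := by
  have hb : 0 < (1 + t / a) / 2 := by positivity
  rw [← ofReal_integral_eq_lintegral_ofReal
    (integrableOn_rpow_mul_exp_neg_mul_rpow (by linarith) two_pos hb)]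
  · rw [integral_rpow_mul_exp_neg_mul_rpow two_pos (by linarith) hb]
    have e1 : -(2 * s - 1 + 1) / 2 = -s := by ring
    have e2 : (2 * s - 1 + 1) / 2 = s := by ring
    have e3 : (1 + t / a) / 2 = (a + t) / (2 * a) := by field_simp
    rw [e1, e2, e3, Real.div_rpow (by positivity) (by positivity),
      Real.rpow_neg (x := 2 * a) (by positivity)]
    congr 1
    rw [div_inv_eq_mul]
    ring
  · refine (ae_restrict_mem measurableSet_Ioi).mono fun y hy => ?_
    have : (0:ℝ) < y := hy
    simp only [Pi.zero_apply]
    positivity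

lemma chi_meas (ν : ℝ) : Measurable (chiTwoNuPDF ν) := by
  unfold chiTwoNuPDF
  fun_prop

lemma chi_pos (ν : ℝ) (hν : 0 < ν) (y : ℝ) (hy : 0 < y) : 0 < chiTwoNuPDF ν y := by
  unfold chiTwoNuPDF
  have := Real.Gamma_pos_of_pos hν
  positivity

theorem spd_matern_spectral_sampling {Ω : Type*} [MeasurableSpace Ω]
    (P : Measure Ω) [IsProbabilityMeasure P]
    (d : ℕ) (hd : 1 ≤ d) (ν κ : ℝ) (hν : 0 < ν) (hκ : 0 < κ)
    (n R2 γ : ℝ)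
    (hn : n = (d : ℝ) * ((d : ℝ) + 1) / 2)
    (hR2 : R2 = ((d : ℝ) ^ 3 - (d : ℝ)) / 12)
    (hγ : γ = (2 * ν / κ ^ 2 + R2) ^ (-(1 : ℝ) / 2))
    (X : Ω → EuclideanSpace ℝ (Fin d)) (Y : Ω → ℝ)
    (hX : Measure.map X P =
      volume.withDensity fun x => ENNReal.ofReal
        (Real.exp (-γ ^ 2 * ‖x‖ ^ 2 / 2) * vandermondeAbs d x /
          ∫ x' : EuclideanSpace ℝ (Fin d),
            Real.exp (-γ ^ 2 * ‖x'‖ ^ 2 / 2) * vandermondeAbs d x'))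
    (hY : Measure.map Y P =
      volume.withDensity fun ψ =>
        ENNReal.ofReal ((Ioi (0 : ℝ)).indicator (chiTwoNuPDF ν) ψ))
    (hXY : IndepFun X Y P) :
    Integrable (fun z : EuclideanSpace ℝ (Fin d) =>
      (2 * ν / κ ^ 2 + ‖z‖ ^ 2 + R2) ^ (-ν - n / 2) * vandermondeAbs d z) ∧
    (0 < ∫ z : EuclideanSpace ℝ (Fin d),
      (2 * ν / κ ^ 2 + ‖z‖ ^ 2 + R2) ^ (-ν - n / 2) * vandermondeAbs d z) ∧
    Measure.map (fun ω => (Y ω)⁻¹ • X ω) P =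
      volume.withDensity fun z => ENNReal.ofReal
        ((2 * ν / κ ^ 2 + ‖z‖ ^ 2 + R2) ^ (-ν - n / 2) * vandermondeAbs d z /
          ∫ z' : EuclideanSpace ℝ (Fin d),
            (2 * ν / κ ^ 2 + ‖z'‖ ^ 2 + R2) ^ (-ν - n / 2) * vandermondeAbs d z') := by
  
  have hd1 : (1:ℝ) ≤ d := by exact_mod_cast hd
  have hR0 : 0 ≤ R2 := by
    rw [hR2]
    have : (d:ℝ)^3 - d = d * ((d - 1) * (d + 1)) := by ring
    rw [this]
    have : (0:ℝ) ≤ d - 1 := by linarith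
    positivity
  set a := 2 * ν / κ ^ 2 + R2 with ha_def
  have ha : 0 < a := by positivity
  have hγ2 : γ ^ 2 = a⁻¹ := by
    rw [hγ, ← Real.rpow_natCast, ← Real.rpow_mul ha.le, ← Real.rpow_neg_one]
    norm_num
  have hexp : ∀ x : EuclideanSpace ℝ (Fin d),
      -γ ^ 2 * ‖x‖ ^ 2 / 2 = -(a⁻¹ / 2) * ‖x‖ ^ 2 := fun x => by rw [hγ2]; ring
  have hG : ∀ z : EuclideanSpace ℝ (Fin d),
      2 * ν / κ ^ 2 + ‖z‖ ^ 2 + R2 = a + ‖z‖ ^ 2 := fun z => by rw [ha_def]; ring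
  simp only [hexp] at hX
  simp only [hG]
  set Z := ∫ x : EuclideanSpace ℝ (Fin d), Real.exp (-(a⁻¹ / 2) * ‖x‖ ^ 2) * vandermondeAbs d x
    with hZ
  have hZ0 : 0 < Z := gv_pos d _ (by positivity)
  have hZi := gv_int d (a⁻¹ / 2) (by positivity)
  have hvc := vand_cont d
  have hvn := vand_nonneg d
  have hcm := chi_meas ν
  set f : EuclideanSpace ℝ (Fin d) → ENNReal := fun x => ENNReal.ofReal
        (Real.exp (-(a⁻¹ / 2) * ‖x‖ ^ 2) * vandermondeAbs d x / Z) with hf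
  set g : ℝ → ENNReal := fun ψ =>
        ENNReal.ofReal ((Ioi (0 : ℝ)).indicator (chiTwoNuPDF ν) ψ) with hg
  have hfm : Measurable f := by
    have := hvc.measurable
    fun_prop
  have hgm : Measurable g := (hcm.indicator measurableSet_Ioi).ennreal_ofReal
  have hXm : AEMeasurable X P := by
    by_contra hc
    rw [Measure.map_of_not_aemeasurable hc] at hX
    have h1 : ∫⁻ x, f x = 0 := by
      rw [← setLIntegral_univ, ← withDensity_apply _ MeasurableSet.univ, ← hX]
      simp
    rw [hf, ← ofReal_integral_eq_lintegral_ofReal (hZi.div_const Z)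
      (Filter.Eventually.of_forall fun x =>
        div_nonneg (mul_nonneg (Real.exp_nonneg _) (hvn x)) hZ0.le),
      integral_div, ← hZ, div_self hZ0.ne'] at h1
    simp at h1
  have hYm : AEMeasurable Y P := by
    by_contra hc
    rw [Measure.map_of_not_aemeasurable hc] at hY
    have h1 : (volume.withDensity g) (Ioi 0) = 0 := by
      rw [← hY]; simp
    rw [withDensity_apply _ measurableSet_Ioi, setLIntegral_eq_zero_iff measurableSet_Ioi hgm,
      ] at h1
    have h2 : volume (Ioi (0:ℝ)) = 0 := by
      refine measure_mono_null (fun y hy => ?_) (ae_iff.1 h1)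
      simp only [mem_ofPred_eq, not_forall]
      refine ⟨hy, ?_⟩
      simp only [hg, indicator_of_mem hy]
      simpa using chi_pos ν hν y hy
    simp at h2
  have hpX := Measure.isProbabilityMeasure_map hXm
  have hpY := Measure.isProbabilityMeasure_map hYm
  have hprod := (indepFun_iff_map_prod_eq_prod_map_map hXm hYm).1 hXY
  have hmap : Measure.map (fun ω => (Y ω)⁻¹ • X ω) P = Measure.map
      (fun p : EuclideanSpace ℝ (Fin d) × ℝ => p.2⁻¹ • p.1)
      (Measure.map (fun ω => (X ω, Y ω)) P) := by
    rw [AEMeasurable.map_map_of_aemeasurable _ (hXm.prodMk hYm)]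
    · rfl
    · exact Measurable.aemeasurable (by fun_prop)
  have hZm : AEMeasurable (fun ω => (Y ω)⁻¹ • X ω) P := hYm.inv.smul hXm
  have hprob := Measure.isProbabilityMeasure_map hZm
  rw [hX] at hpX
  rw [hY] at hpY
  rw [hX, hY] at hprod
  rw [hprod, map_ratio d f g hfm hgm (fun y hy => by simp [hg, hy])] at hmap
  have hs : 0 < ν + n / 2 := by rw [hn]; positivity
  obtain ⟨C, hC, hdens⟩ : ∃ C : ℝ, 0 < C ∧ ∀ z : EuclideanSpace ℝ (Fin d),
      ∫⁻ y in Ioi 0, g y * (ENNReal.ofReal (y ^ d) * f (y • z)) =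
      ENNReal.ofReal (C * ((a + ‖z‖ ^ 2) ^ (-ν - n / 2) * vandermondeAbs d z)) := by
    have hΓ := Real.Gamma_pos_of_pos hν
    have hΓ2 := Real.Gamma_pos_of_pos hs
    refine ⟨((2 : ℝ) ^ (1 - ν) * (Real.Gamma ν)⁻¹ / Z) *
      ((2 * a) ^ (ν + n / 2) * (1 / 2) * Real.Gamma (ν + n / 2)), by positivity, fun z => ?_⟩
    have key : ∀ y ∈ Ioi (0:ℝ), g y * (ENNReal.ofReal (y ^ d) * f (y • z)) =
        ENNReal.ofReal ((2 : ℝ) ^ (1 - ν) * (Real.Gamma ν)⁻¹ / Z * vandermondeAbs d z) *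
        ENNReal.ofReal (y ^ (2 * (ν + n / 2) - 1) *
          Real.exp (-((1 + ‖z‖ ^ 2 / a) / 2) * y ^ (2:ℝ))) := by
      intro y hy
      have hy0 : (0:ℝ) < y := hy
      have hvz := hvn z
      simp only [hg, hf, indicator_of_mem hy]
      rw [← ENNReal.ofReal_mul (by positivity), ← ENNReal.ofReal_mul (chi_pos ν hν y hy).le,
        ← ENNReal.ofReal_mul (by positivity)]
      congr 1
      have e1 : 2 * (ν + n / 2) - 1 = (2 * ν - 1) + (d : ℝ) + (vcard d : ℝ) := by
        rw [add_assoc, vcard_eq, ← hn]; ring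
      have e2 : Real.exp (-((1 + ‖z‖ ^ 2 / a) / 2) * y ^ (2:ℝ)) =
          Real.exp (-y ^ 2 / 2) * Real.exp (-(a⁻¹ / 2) * ‖y • z‖ ^ 2) := by
        rw [← Real.exp_add, norm_smul, Real.norm_of_nonneg hy0.le, Real.rpow_two]
        congr 1
        field_simp
        ring
      rw [e1, e2, Real.rpow_add hy0, Real.rpow_add hy0, Real.rpow_natCast, Real.rpow_natCast,
        vand_smul d y hy0]
      unfold chiTwoNuPDF
      ring
    rw [setLIntegral_congr_fun measurableSet_Ioi key, lintegral_const_mul _ (by fun_prop),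
      inner_int a _ ha hs _ (by positivity), ← ENNReal.ofReal_mul
        (mul_nonneg (by positivity) (hvn z))]
    congr 1
    rw [show -(ν + n / 2) = -ν - n / 2 by ring]
    ring
  simp only [hdens] at hmap
  rw [hmap] at hprob
  have hone := hprob.measure_univ
  rw [withDensity_apply _ MeasurableSet.univ, setLIntegral_univ] at hone
  have hGc : Continuous fun z : EuclideanSpace ℝ (Fin d) =>
      (a + ‖z‖ ^ 2) ^ (-ν - n / 2) * vandermondeAbs d z := by
    refine Continuous.mul (Continuous.rpow_const (by fun_prop) fun z => Or.inl ?_) hvc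
    positivity
  have hGn : ∀ z : EuclideanSpace ℝ (Fin d),
      0 ≤ (a + ‖z‖ ^ 2) ^ (-ν - n / 2) * vandermondeAbs d z := fun z =>
    mul_nonneg (by positivity) (hvn z)
  have hCGi : Integrable fun z : EuclideanSpace ℝ (Fin d) =>
      C * ((a + ‖z‖ ^ 2) ^ (-ν - n / 2) * vandermondeAbs d z) := by
    refine ⟨(hGc.const_mul C).aestronglyMeasurable, ?_⟩
    rw [hasFiniteIntegral_iff_ofReal
      (Filter.Eventually.of_forall fun z => mul_nonneg hC.le (hGn z)), hone]
    simp
  have hGi : Integrable fun z : EuclideanSpace ℝ (Fin d) =>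
      (a + ‖z‖ ^ 2) ^ (-ν - n / 2) * vandermondeAbs d z := by
    have := hCGi.const_mul C⁻¹
    simpa only [← mul_assoc, inv_mul_cancel₀ hC.ne', one_mul] using this
  have hpos : 0 < ∫ z : EuclideanSpace ℝ (Fin d),
      (a + ‖z‖ ^ 2) ^ (-ν - n / 2) * vandermondeAbs d z := by
    obtain ⟨x, hx⟩ := vand_ne d
    refine MeasureTheory.integral_pos_of_integrable_nonneg_nonzero (x := x) hGc hGi hGn (mul_ne_zero ?_ hx)
    positivity
  refine ⟨hGi, hpos, ?_⟩
  rw [← ofReal_integral_eq_lintegral_ofReal hCGi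
    (Filter.Eventually.of_forall fun z => mul_nonneg hC.le (hGn z)), integral_const_mul,
    ENNReal.ofReal_eq_one] at hone
  rw [hmap]
  congr 1
  funext z
  congr 1
  rw [eq_div_iff hpos.ne']
  linear_combination ((a + ‖z‖ ^ 2) ^ (-ν - n / 2) * vandermondeAbs d z) * hone
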